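/- Let G=(Q,Σ,δ,I,F) be an NFA, Σ_o ⊆ Σ a set of observable events, and C ⊆ Q a set of critical states. Then G is NOT critically observable with respect to Σ_o and C if and only if there is a reachable state of the composition G⫙G that belongs to the set C×(Q∖C). -/

import Mathlib

/-- One step of an NFA transition function on a set of states: δ(S,a) = ⋃_{q∈S} δ(q,a). -/
def dStep {Q A : Type*} (δ : Q → A → Set Q) (S : Set Q) (a : A) : Set Q := ⋃ q ∈ S, δ q a

/-- Extension of the transition function to words: δ(S,ε)=S, δ(S,aw)=δ(δ(S,a),w). -/
def dRun {Q A : Type*} (δ : Q → A → Set Q) (S : Set Q) : List A → Set Q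
  | [] => S
  | a :: w => dRun δ (dStep δ S a) w

open Classical in
/-- Natural projection to observable events: erases all unobservable letters. -/
noncomputable def proj {A : Type*} (obs : A → Prop) : List A → List A
  | [] => []
  | a :: w => if obs a then a :: proj obs w else proj obs w

/-- The state estimate δ(I,P⁻¹P(w)) = ⋃_{v : P(v)=P(w)} δ(I,v). -/
noncomputable def dEst {Q A : Type*} (δ : Q → A → Set Q) (obs : A → Prop) (I : Set Q)
    (w : List A) : Set Q :=
  ⋃ v ∈ {v : List A | proj obs v = proj obs w}, dRun δ I v

/-- Critical observability of an NFA. -/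
def CritObs {Q A : Type*} (δ : Q → A → Set Q) (obs : A → Prop) (I C : Set Q) : Prop :=
  ∀ w : List A, dRun δ I w ≠ ∅ → dEst δ obs I w ⊆ C ∨ dEst δ obs I w ⊆ Cᶜ

open Classical in
/-- The transition function f of the composition G⫙G: observable events are synchronized,
unobservable events are interleaved. -/
noncomputable def compStep {Q A : Type*} (δ : Q → A → Set Q) (obs : A → Prop)
    (s : Q × Q) (e : A) : Set (Q × Q) :=
  if obs e then δ s.1 e ×ˢ δ s.2 e
  else (δ s.1 e ×ˢ {s.2}) ∪ ({s.1} ×ˢ δ s.2 e)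

theorem mem_dStep {Q A : Type*} {δ : Q → A → Set Q} {S : Set Q} {a : A} {p : Q} :
    p ∈ dStep δ S a ↔ ∃ q ∈ S, p ∈ δ q a := by
  simp [dStep]

theorem mem_dRun_iff_exists {Q A : Type*} {δ : Q → A → Set Q} {S : Set Q} {w : List A} {r : Q} :
    r ∈ dRun δ S w ↔ ∃ q ∈ S, r ∈ dRun δ {q} w := by
  induction w generalizing S with
  | nil => simp [dRun]
  | cons a w ih =>
    simp only [dRun]
    rw [ih]
    constructor
    · rintro ⟨p, hp, hr⟩
      obtain ⟨q, hq, hpq⟩ := mem_dStep.1 hp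
      exact ⟨q, hq, ih.2 ⟨p, mem_dStep.2 ⟨q, rfl, hpq⟩, hr⟩⟩
    · rintro ⟨q, hq, hr⟩
      obtain ⟨p, hp, hpr⟩ := ih.1 hr
      obtain ⟨q, rfl, hpq⟩ := mem_dStep.1 hp
      exact ⟨p, mem_dStep.2 ⟨q, hq, hpq⟩, hpr⟩

theorem mem_dRun_cons_singleton {Q A : Type*} {δ : Q → A → Set Q} {q : Q} {a : A} {w : List A}
    {r : Q} : r ∈ dRun δ {q} (a :: w) ↔ ∃ p ∈ δ q a, r ∈ dRun δ {p} w := by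
  rw [dRun, mem_dRun_iff_exists]
  simp [mem_dStep]

/-- Every run of the composition splits into two runs with the same projection. -/
theorem exists_runs_of_mem_dRun_compStep {Q A : Type*} {δ : Q → A → Set Q} {obs : A → Prop}
    {u : List A} {s z : Q × Q} (hz : z ∈ dRun (compStep δ obs) {s} u) :
    ∃ v v' : List A, proj obs v = proj obs v' ∧ z.1 ∈ dRun δ {s.1} v ∧
      z.2 ∈ dRun δ {s.2} v' := by
  induction u generalizing s with
  | nil =>
    obtain rfl : z = s := hz
    exact ⟨[], [], rfl, rfl, rfl⟩
  | cons e u ih =>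
    obtain ⟨⟨p, q⟩, ht, hz⟩ := mem_dRun_cons_singleton.1 hz
    obtain ⟨v, v', hv, h₁, h₂⟩ := ih hz
    by_cases he : obs e
    · rw [compStep, if_pos he] at ht
      exact ⟨e :: v, e :: v', by simp [proj, he, hv],
        mem_dRun_cons_singleton.2 ⟨p, ht.1, h₁⟩, mem_dRun_cons_singleton.2 ⟨q, ht.2, h₂⟩⟩
    · rw [compStep, if_neg he] at ht
      obtain ⟨hp, rfl : q = s.2⟩ | ⟨rfl : p = s.1, hq⟩ := ht
      · exact ⟨e :: v, v', by simp [proj, he, hv], mem_dRun_cons_singleton.2 ⟨p, hp, h₁⟩, h₂⟩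
      · exact ⟨v, e :: v', by simp [proj, he, hv], h₁, mem_dRun_cons_singleton.2 ⟨q, hq, h₂⟩⟩

/-- Two runs with the same projection can be combined into a run of the composition. -/
theorem exists_mem_dRun_compStep {Q A : Type*} {δ : Q → A → Set Q} {obs : A → Prop}
    {v v' : List A} {x y p q : Q} (hv : proj obs v = proj obs v') (hp : p ∈ dRun δ {x} v)
    (hq : q ∈ dRun δ {y} v') : ∃ u, (p, q) ∈ dRun (compStep δ obs) {(x, y)} u := by
  induction v generalizing x y v' with
  | nil =>
    obtain rfl : p = x := hp
    induction v' generalizing y with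
    | nil =>
      obtain rfl : q = y := hq
      exact ⟨[], rfl⟩
    | cons b v' ih =>
      by_cases hb : obs b
      · simp [proj, hb] at hv
      · obtain ⟨y', hy, hq⟩ := mem_dRun_cons_singleton.1 hq
        obtain ⟨u, hu⟩ := ih (by simpa [proj, hb] using hv) hq
        exact ⟨b :: u, mem_dRun_cons_singleton.2 ⟨(p, y'), by simp [compStep, hb, hy], hu⟩⟩
  | cons a v ih =>
    obtain ⟨x', hx, hp'⟩ := mem_dRun_cons_singleton.1 hp
    by_cases ha : obs a
    · induction v' generalizing y with
      | nil => simp [proj, ha] at hv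
      | cons b v' ih' =>
        obtain ⟨y', hy, hq'⟩ := mem_dRun_cons_singleton.1 hq
        by_cases hb : obs b
        · simp only [proj, ha, hb, if_true, List.cons.injEq] at hv
          obtain ⟨rfl, hv⟩ := hv
          obtain ⟨u, hu⟩ := ih hv hp' hq'
          exact ⟨a :: u, mem_dRun_cons_singleton.2 ⟨(x', y'), by simp [compStep, ha, hx, hy], hu⟩⟩
        · obtain ⟨u, hu⟩ := ih' (by simpa [proj, hb] using hv) hq'
          exact ⟨b :: u, mem_dRun_cons_singleton.2 ⟨(x, y'), by simp [compStep, hb, hy], hu⟩⟩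
    · obtain ⟨u, hu⟩ := ih (by simpa [proj, ha] using hv) hp' hq
      exact ⟨a :: u, mem_dRun_cons_singleton.2 ⟨(x', y), by simp [compStep, ha, hx], hu⟩⟩

/-- G is not critically observable w.r.t. Σ_o and C iff some reachable
state of G⫙G belongs to C×(Q∖C). -/
theorem stmt2 {Q A : Type*} [Finite Q] [Finite A] (δ : Q → A → Set Q) (obs : A → Prop)
    (I : Set Q) (F : Set Q) (hI : I.Nonempty) (C : Set Q) :
    ¬ CritObs δ obs I C ↔
      ∃ u : List A, ∃ z ∈ dRun (compStep δ obs) (I ×ˢ I) u, z.1 ∈ C ∧ z.2 ∉ C := by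
  constructor
  · intro h
    simp only [CritObs, not_forall, not_or, Set.not_subset, dEst, Set.mem_iUnion₂,
      Set.mem_compl_iff, not_not] at h
    obtain ⟨w, -, ⟨q, ⟨v', hv', hq⟩, hqC⟩, p, ⟨v, hv, hp⟩, hpC⟩ := h
    obtain ⟨x, hx, hp⟩ := mem_dRun_iff_exists.1 hp
    obtain ⟨y, hy, hq⟩ := mem_dRun_iff_exists.1 hq
    obtain ⟨u, hu⟩ := exists_mem_dRun_compStep (Eq.trans hv (Eq.symm hv')) hp hq
    exact ⟨u, (p, q), mem_dRun_iff_exists.2 ⟨(x, y), ⟨hx, hy⟩, hu⟩, hpC, hqC⟩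
  · rintro ⟨u, z, hz, hzC, hzC'⟩ h
    obtain ⟨s, hs, hz⟩ := mem_dRun_iff_exists.1 hz
    obtain ⟨v, v', hv, h₁, h₂⟩ := exists_runs_of_mem_dRun_compStep hz
    have h₁' : z.1 ∈ dRun δ I v := mem_dRun_iff_exists.2 ⟨s.1, hs.1, h₁⟩
    have h₂' : z.2 ∈ dRun δ I v' := mem_dRun_iff_exists.2 ⟨s.2, hs.2, h₂⟩
    obtain hC | hC := h v (Set.nonempty_iff_ne_empty.1 ⟨z.1, h₁'⟩)
    · exact hzC' (hC (Set.mem_iUnion₂.2 ⟨v', hv.symm, h₂'⟩))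
    · exact hC (Set.mem_iUnion₂.2 ⟨v, rfl, h₁'⟩) hzC
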